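/- arXiv:1208.0919 — 2 statements merged into one kernel-verified Lean document; each statement's English description precedes it below -/
import Mathlib

section
/- ∑_{N ≤ x} K*(N) = x + O(x/log x) for x ≥ 2, where K*(N) = K(N)·N/φ(N) and K(N) = ∏_{p∤N}(1 − (((N−1)/p)²·p+1)/((p−1)²(p+1))) · ∏_{p|N}(1 − 1/(p^{ν_p(N)}(p−1))). -/
/-- The Euler factor at `p` of the function `K(N)` from Definition 1. Here
`((N-1)/p)² = 1` if `p ∤ N - 1` and `0` if `p ∣ N - 1`. -/
noncomputable def Kfactor (N : ℕ) (p : ℕ) : ℝ :=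
  if p ∣ N then
    1 - 1/((p:ℝ)^(N.factorization p) * ((p:ℝ) - 1))
  else
    1 - ((if (p:ℤ) ∣ ((N:ℤ) - 1) then (0:ℝ) else 1) * (p:ℝ) + 1)
          / (((p:ℝ) - 1)^2 * ((p:ℝ) + 1))

/-- The function `K(N)` of Definition 1, as a product over all primes. -/
noncomputable def K (N : ℕ) : ℝ := ∏' p : Nat.Primes, Kfactor N (p : ℕ)

/-- The function `K*(N) = K(N)·N/φ(N)`. -/
noncomputable def Kstar (N : ℕ) : ℝ := K N * (N:ℝ) / (Nat.totient N : ℝ)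

/-- local mean-zero components -/
noncomputable def gloc (p k N : ℕ) : ℝ :=
  if k = 0 then 1 else if k = 1 then
    ((p:ℝ)^2 * (if p ∣ N then 1 else 0) + (p:ℝ) * (if (p:ℤ) ∣ ((N:ℤ) - 1) then 1 else 0) - ((p:ℝ)+1))
      / (((p:ℝ) - 1)^2 * ((p:ℝ) + 1))
  else ((p:ℝ)^2 / (p:ℝ)^k) * ((p:ℝ) * (if p^k ∣ N then 1 else 0) - (if p^(k-1) ∣ N then 1 else 0))
      / (((p:ℝ) - 1)^2 * ((p:ℝ) + 1))

noncomputable def gam (n N : ℕ) : ℝ :=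
  if n = 0 then 0 else n.factorization.prod (fun p k => gloc p k N)

lemma gam_zero (N : ℕ) : gam 0 N = 0 := by simp [gam]

lemma gam_one (N : ℕ) : gam 1 N = 1 := by simp [gam]

lemma gam_mul {m n : ℕ} (N : ℕ) (h : Nat.Coprime m n) : gam (m * n) N = gam m N * gam n N := by
  by_cases hm : m = 0
  · simp [hm, gam_zero]
  by_cases hn : n = 0
  · simp [hn, gam_zero]
  simp only [gam, hm, hn, mul_eq_zero, or_self, if_false]
  rw [Nat.factorization_mul_of_coprime h, Finsupp.prod_add_index_of_disjoint]
  exact h.disjoint_primeFactors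

lemma gam_prime_pow {p : ℕ} (hp : p.Prime) (k N : ℕ) : gam (p^k) N = gloc p k N := by
  have : p^k ≠ 0 := pow_ne_zero _ hp.ne_zero
  simp only [gam, this, if_false]
  rw [hp.factorization_pow, Finsupp.prod_single_index]
  simp [gloc]

lemma gloc_congr {p k N M : ℕ} (h : N ≡ M [MOD p^k]) : gloc p k N = gloc p k M := by
  rcases k with _ | _ | k
  · simp [gloc]
  · have h1 : p ∣ N ↔ p ∣ M := by
      simpa using h.dvd_iff (d := p) (by simp)
    have h2 : (p:ℤ) ∣ (N:ℤ) - 1 ↔ (p:ℤ) ∣ (M:ℤ) - 1 := by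
      have h3 : (p:ℤ) ∣ (M:ℤ) - N := by
        have := (Nat.modEq_iff_dvd.1 h); simpa using this
      constructor
      · intro h4
        have := dvd_add h3 h4
        simpa using this
      · intro h4
        have := dvd_sub h4 h3
        simpa using this
    simp [gloc, h1, h2]
  · have h1 : p^(k+2) ∣ N ↔ p^(k+2) ∣ M := h.dvd_iff dvd_rfl
    have h2 : p^(k+1) ∣ N ↔ p^(k+1) ∣ M := h.dvd_iff (pow_dvd_pow _ (by omega))
    simp [gloc, h1, h2]

lemma gam_congr {n N M : ℕ} (h : N ≡ M [MOD n]) : gam n N = gam n M := by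
  unfold gam
  split_ifs with hn
  · rfl
  refine Finsupp.prod_congr fun p _ => gloc_congr (h.of_dvd (Nat.ordProj_dvd n p))

lemma w_bound {p : ℝ} (hp : 2 ≤ p) : 1 / ((p - 1)^2 * (p + 1)) ≤ 4 / p^3 := by
  rw [div_le_div_iff₀ (by have : 0 < p - 1 := by linarith
                          positivity) (by positivity)]
  nlinarith [mul_nonneg (sub_nonneg.2 hp) (by positivity : 0 ≤ p^2)]

lemma gloc_bound {p : ℕ} (hp : p.Prime) {k : ℕ} (hk : 0 < k) (N : ℕ) :
    |gloc p k N| ≤ 12 * (Nat.gcd (p^k) N : ℝ) / ((p^k : ℕ):ℝ)^2 := by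
  have hp2 : (2:ℝ) ≤ p := by exact_mod_cast hp.two_le
  have hp0 : (0:ℝ) < p := by linarith
  have hw := w_bound hp2
  have hw0 : 0 ≤ 1 / (((p:ℝ) - 1)^2 * ((p:ℝ) + 1)) := by positivity
  rcases k with _ | _ | k
  · omega
  · simp only [gloc, zero_add, pow_one, one_ne_zero, if_false, if_true]
    rw [div_eq_mul_one_div, abs_mul, abs_of_nonneg hw0]
    have key : |(p:ℝ)^2 * (if p ∣ N then 1 else 0) + (p:ℝ) * (if (p:ℤ) ∣ ((N:ℤ) - 1) then 1 else 0) - ((p:ℝ)+1)| ≤ 3 * p * (Nat.gcd p N : ℝ) := by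
      have hg : (1:ℝ) ≤ (Nat.gcd p N : ℝ) := by
        exact_mod_cast Nat.gcd_pos_of_pos_left _ hp.pos
      by_cases h1 : p ∣ N
      · rw [Nat.gcd_eq_left h1]
        simp only [h1, if_true]
        split_ifs <;> rw [abs_le] <;> constructor <;> nlinarith
      · simp only [h1, if_false]
        split_ifs <;> rw [abs_le] <;> constructor <;> nlinarith
    calc _ ≤ (3 * p * (Nat.gcd p N : ℝ)) * (4 / (p:ℝ)^3) := by gcongr
      _ = _ := by field_simp; ring
  · simp only [gloc]
    rw [if_neg (by omega), if_neg (by omega), div_eq_mul_one_div, abs_mul, abs_of_nonneg hw0]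
    simp only [show k + 1 + 1 - 1 = k + 1 by omega, show k + 1 + 1 = k + 2 by omega]
    have key : |(p:ℝ) * (if p^(k+2) ∣ N then 1 else 0) - (if p^(k+1) ∣ N then 1 else 0)| ≤ (Nat.gcd (p^(k+2)) N : ℝ) / (p:ℝ)^(k+1) := by
      rw [le_div_iff₀ (by positivity)]
      by_cases h1 : p^(k+2) ∣ N
      · have h2 : p^(k+1) ∣ N := (pow_dvd_pow _ (by omega)).trans h1
        rw [Nat.gcd_eq_left h1]
        simp only [h1, h2, if_true]
        rw [abs_of_nonneg (by linarith)]
        push_cast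
        have : (0:ℝ) < (p:ℝ)^(k+1) := by positivity
        rw [pow_succ _ (k+1)]
        nlinarith
      · by_cases h2 : p^(k+1) ∣ N
        · simp only [h1, h2, if_true, if_false]
          have : p^(k+1) ≤ Nat.gcd (p^(k+2)) N :=
            Nat.le_of_dvd (Nat.gcd_pos_of_pos_left _ (pow_pos hp.pos _))
              (Nat.dvd_gcd (pow_dvd_pow _ (by omega)) h2)
          have : (p:ℝ)^(k+1) ≤ Nat.gcd (p^(k+2)) N := by exact_mod_cast this
          simpa using this
        · simp [h1, h2]
    rw [abs_mul, abs_of_nonneg (by positivity : 0 ≤ (p:ℝ)^2 / (p:ℝ)^(k+2))]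
    calc _ ≤ (p:ℝ)^2 / (p:ℝ)^(k+2) * ((Nat.gcd (p^(k+2)) N : ℝ) / (p:ℝ)^(k+1)) * (4 / (p:ℝ)^3) := by gcongr
      _ = 4 * (Nat.gcd (p^(k+2)) N : ℝ) / ((p^(k+2) : ℕ):ℝ)^2 := by
        push_cast; field_simp; ring
      _ ≤ _ := by gcongr; norm_num

lemma gam_bound {n : ℕ} (hn : n ≠ 0) (N : ℕ) :
    |gam n N| ≤ 12 ^ (n.primeFactors.card) * (Nat.gcd n N : ℝ) / (n:ℝ)^2 := by
  induction n using Nat.recOnPosPrimePosCoprime with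
  | prime_pow p k hp hk =>
    rw [gam_prime_pow hp, Nat.primeFactors_prime_pow hk.ne' hp]
    simpa using gloc_bound hp hk N
  | zero => exact absurd rfl hn
  | one => simp [gam_one]
  | coprime a b ha hb hab iha ihb =>
    rw [gam_mul N hab, abs_mul, hab.primeFactors_mul, Finset.card_union_of_disjoint hab.disjoint_primeFactors,
      Nat.gcd_comm (a * b), hab.gcd_mul N, Nat.gcd_comm N a, Nat.gcd_comm N b]
    refine (mul_le_mul (iha (by omega)) (ihb (by omega)) (abs_nonneg _) (by positivity)).trans (le_of_eq ?_)
    push_cast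
    rw [pow_add]; field_simp

lemma sum_ind (q d : ℕ) : ∑ i ∈ Finset.range q, (if d ∣ i + 1 then (1:ℝ) else 0) = ((q / d : ℕ) : ℝ) := by
  rw [← Nat.card_multiples, Finset.sum_boole]

lemma gloc_sum {p : ℕ} (hp : p.Prime) {k : ℕ} (hk : 0 < k) :
    ∑ i ∈ Finset.range (p^k), gloc p k (i+1) = 0 := by
  have hp0 : (p:ℝ) ≠ 0 := by exact_mod_cast hp.ne_zero
  rcases k with _ | _ | k
  · omega
  · simp only [gloc, zero_add, pow_one, one_ne_zero, if_false, if_true]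
    rw [← Finset.sum_div, Finset.sum_sub_distrib, Finset.sum_add_distrib, ← Finset.mul_sum, ← Finset.mul_sum, sum_ind]
    have : ∑ i ∈ Finset.range p, (if (p:ℤ) ∣ (((i+1:ℕ):ℤ) - 1) then (1:ℝ) else 0) = 1 := by
      rw [Finset.sum_eq_single 0]
      · simp
      · intro b hb hb0
        rw [if_neg]
        simp only [Nat.cast_add, Nat.cast_one, add_sub_cancel_right, Int.natCast_dvd_natCast]
        intro h
        have := Nat.le_of_dvd (by omega) h
        have := Finset.mem_range.1 hb
        omega
      · intro h; exact absurd (Finset.mem_range.2 hp.pos) h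
    rw [this, Nat.div_self hp.pos]
    simp
    left; ring
  · simp only [gloc]
    simp only [show k + 1 + 1 - 1 = k + 1 by omega, show k + 1 + 1 = k + 2 by omega, show k + 2 ≠ 0 by omega,
      show k + 2 ≠ 1 by omega, if_false]
    rw [← Finset.sum_div, ← Finset.mul_sum, Finset.sum_sub_distrib, ← Finset.mul_sum, sum_ind, sum_ind,
      Nat.div_self (pow_pos hp.pos _), Nat.pow_div (by omega) hp.pos]
    simp

lemma sum_crt {a b : ℕ} (ha : 0 < a) (hb : 0 < b) (hab : Nat.Coprime a b) (f g : ℕ → ℝ)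
    (hf : ∀ N M, N ≡ M [MOD a] → f N = f M) (hg : ∀ N M, N ≡ M [MOD b] → g N = g M) :
    ∑ i ∈ Finset.range (a*b), f i * g i = (∑ i ∈ Finset.range a, f i) * ∑ i ∈ Finset.range b, g i := by
  rw [Finset.sum_mul_sum, ← Finset.sum_product']
  refine Finset.sum_nbij' (fun i => (i % a, i % b)) (fun x => (Nat.chineseRemainder hab x.1 x.2 : ℕ)) ?_ ?_ ?_ ?_ ?_
  · intro i _
    simp [Nat.mod_lt _ ha, Nat.mod_lt _ hb]
  · intro x _
    simpa using Nat.chineseRemainder_lt_mul hab x.1 x.2 ha.ne' hb.ne'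
  · intro i hi
    have h := (Nat.chineseRemainder hab (i % a) (i % b)).2
    have h1 : (Nat.chineseRemainder hab (i % a) (i % b) : ℕ) ≡ i [MOD a*b] :=
      (Nat.modEq_and_modEq_iff_modEq_mul hab).1 ⟨h.1.trans (Nat.mod_modEq _ _), h.2.trans (Nat.mod_modEq _ _)⟩
    exact h1.eq_of_lt_of_lt (Nat.chineseRemainder_lt_mul hab _ _ ha.ne' hb.ne') (Finset.mem_range.1 hi)
  · rintro ⟨x, y⟩ hx
    simp only [Finset.mem_product, Finset.mem_range] at hx
    have h := (Nat.chineseRemainder hab x y).2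
    ext
    · exact Nat.mod_eq_of_modEq h.1 hx.1
    · exact Nat.mod_eq_of_modEq h.2 hx.2
  · intro i _
    rw [hf (i % a) i (Nat.mod_modEq _ _), hg (i % b) i (Nat.mod_modEq _ _)]

lemma gam_sum {n : ℕ} (hn : 1 < n) : ∑ i ∈ Finset.range n, gam n (i+1) = 0 := by
  induction n using Nat.recOnPosPrimePosCoprime with
  | prime_pow p k hp hk =>
    simp_rw [gam_prime_pow hp]
    exact gloc_sum hp hk
  | zero => omega
  | one => omega
  | coprime a b ha hb hab iha ihb =>
    simp_rw [fun N => gam_mul N hab]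
    rw [sum_crt (by omega) (by omega) hab (fun i => gam a (i+1)) (fun i => gam b (i+1))
      (fun N M h => gam_congr (h.add_right 1)) (fun N M h => gam_congr (h.add_right 1)), iha ha, zero_mul]

lemma gam_sum_shift {n : ℕ} (hn : 1 < n) (X : ℕ) :
    ∑ i ∈ Finset.range X, gam n (i+1) = ∑ i ∈ Finset.range (X % n), gam n (i+1) := by
  induction X using Nat.strong_induction_on with
  | _ X ih =>
    by_cases h : X < n
    · rw [Nat.mod_eq_of_lt h]
    · obtain ⟨Y, rfl⟩ := Nat.exists_eq_add_of_le (not_lt.1 h)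
      rw [Finset.sum_range_add, gam_sum hn, zero_add, Nat.add_mod_left, ← ih Y (by omega)]
      refine Finset.sum_congr rfl fun i _ => gam_congr ?_
      rw [add_assoc]
      exact Nat.add_modEq_left

lemma sum_gcd_le {n : ℕ} (hn : n ≠ 0) (X : ℕ) :
    ∑ i ∈ Finset.range X, (Nat.gcd n (i+1) : ℝ) ≤ X * n.divisors.card := by
  calc _ ≤ ∑ i ∈ Finset.range X, ∑ d ∈ n.divisors, (d:ℝ) * (if d ∣ i + 1 then (1:ℝ) else 0) := by
        refine Finset.sum_le_sum fun i _ => ?_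
        have := Finset.single_le_sum (f := fun d : ℕ => (d:ℝ) * (if d ∣ i + 1 then (1:ℝ) else 0)) (s := n.divisors)
          (fun d _ => by positivity) (a := Nat.gcd n (i+1)) (by simp [Nat.gcd_dvd_left, hn])
        simpa [Nat.gcd_dvd_right] using this
    _ = ∑ d ∈ n.divisors, (d:ℝ) * ((X / d : ℕ) : ℝ) := by
        rw [Finset.sum_comm]
        simp_rw [← Finset.mul_sum, sum_ind]
    _ ≤ ∑ d ∈ n.divisors, (X:ℝ) := by
        refine Finset.sum_le_sum fun d _ => ?_
        exact_mod_cast Nat.mul_div_le X d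
    _ = _ := by simp [mul_comm]

/-- coefficient -/
noncomputable def cf (n : ℕ) : ℝ := 12 ^ (n.primeFactors.card) * n.divisors.card

lemma gam_sum_abs {n : ℕ} (hn : n ≠ 0) (X : ℕ) :
    |∑ i ∈ Finset.range X, gam n (i+1)| ≤ X * cf n / (n:ℝ)^2 := by
  refine (Finset.abs_sum_le_sum_abs _ _).trans ?_
  calc _ ≤ ∑ i ∈ Finset.range X, 12 ^ (n.primeFactors.card) * (Nat.gcd n (i+1) : ℝ) / (n:ℝ)^2 :=
        Finset.sum_le_sum fun i _ => gam_bound hn _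
    _ = 12 ^ (n.primeFactors.card) * (∑ i ∈ Finset.range X, (Nat.gcd n (i+1) : ℝ)) / (n:ℝ)^2 := by
        rw [Finset.mul_sum, Finset.sum_div]
    _ ≤ 12 ^ (n.primeFactors.card) * (X * n.divisors.card) / (n:ℝ)^2 := by
        gcongr; exact sum_gcd_le hn X
    _ = _ := by unfold cf; ring

lemma gam_sum_final {n : ℕ} (hn : 1 < n) (X : ℕ) :
    |∑ i ∈ Finset.range X, gam n (i+1)| ≤ Real.sqrt X * Real.sqrt n * cf n / (n:ℝ)^2 := by
  rw [gam_sum_shift hn]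
  refine (gam_sum_abs (by omega) _).trans ?_
  have h0 : 0 ≤ cf n := by unfold cf; positivity
  gcongr
  rw [← Real.sqrt_mul (by positivity)]
  apply Real.le_sqrt_of_sq_le
  rw [sq]
  have h1 : ((X % n : ℕ):ℝ) ≤ X := by exact_mod_cast Nat.mod_le _ _
  have h2 : ((X % n : ℕ):ℝ) ≤ n := by exact_mod_cast (Nat.mod_lt _ (by omega)).le
  gcongr

lemma cf_mul {a b : ℕ} (hab : Nat.Coprime a b) : cf (a * b) = cf a * cf b := by
  unfold cf
  rw [hab.primeFactors_mul, Finset.card_union_of_disjoint hab.disjoint_primeFactors, hab.card_divisors_mul]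
  push_cast
  ring

lemma cf_prime_pow {p : ℕ} (hp : p.Prime) {k : ℕ} (hk : 0 < k) : cf (p^k) = 12 * (k+1) := by
  unfold cf
  rw [Nat.primeFactors_prime_pow hk.ne' hp, Nat.divisors_prime_pow hp]
  simp

lemma cf_le_aux (M : ℝ) (hM1 : 1 ≤ M) (hM : ∀ k : ℕ, 12 * ((k:ℝ)+1) ≤ M * ((2:ℝ)^(1/4:ℝ))^k)
    (n : ℕ) (hn : n ≠ 0) :
    cf n ≤ M ^ (n.primeFactors.filter (· < 24^4)).card * (n:ℝ)^(1/4:ℝ) := by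
  induction n using Nat.recOnPosPrimePosCoprime with
  | prime_pow p k hp hk =>
    rw [cf_prime_pow hp hk, Nat.primeFactors_prime_pow hk.ne' hp, Finset.filter_singleton]
    have e : ((p^k : ℕ):ℝ)^(1/4:ℝ) = ((p:ℝ)^(1/4:ℝ))^k := by
      push_cast
      rw [← Real.rpow_natCast, ← Real.rpow_natCast, ← Real.rpow_mul (by positivity), ← Real.rpow_mul (by positivity), mul_comm]
    rw [e]
    split_ifs with h
    · simp only [Finset.card_singleton, pow_one]
      refine (hM k).trans ?_
      have : (2:ℝ) ≤ p := by exact_mod_cast hp.two_le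
      gcongr
    · simp only [Finset.card_empty, pow_zero, one_mul]
      have h1 : (24:ℝ) ≤ (p:ℝ)^(1/4:ℝ) := by
        have : ((24:ℝ)^(4:ℕ)) ≤ p := by exact_mod_cast not_lt.1 h
        calc (24:ℝ) = ((24:ℝ)^(4:ℕ))^(1/4:ℝ) := by
              rw [← Real.rpow_natCast, ← Real.rpow_mul (by norm_num)]; norm_num
          _ ≤ _ := by gcongr
      calc 12 * ((k:ℝ)+1) ≤ 24^k := by
            have h2 := one_add_mul_le_pow (a := (23:ℝ)) (by norm_num) k
            have h3 : (1:ℝ) ≤ k := by exact_mod_cast hk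
            norm_num at h2
            linarith
        _ ≤ _ := by gcongr
  | zero => exact absurd rfl hn
  | one => simp [cf]
  | coprime a b ha hb hab iha ihb =>
    rw [cf_mul hab, hab.primeFactors_mul, Finset.filter_union, Finset.card_union_of_disjoint
      (Finset.disjoint_filter_filter hab.disjoint_primeFactors)]
    have h0 : 0 ≤ cf b := by unfold cf; positivity
    refine (mul_le_mul (iha (by omega)) (ihb (by omega)) h0 (by positivity)).trans (le_of_eq ?_)
    push_cast
    rw [pow_add, Real.mul_rpow (by positivity) (by positivity)]; ring

lemma cf_le : ∃ A : ℝ, 0 < A ∧ ∀ n : ℕ, n ≠ 0 → cf n ≤ A * (n:ℝ)^(1/4:ℝ) := by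
  set δ : ℝ := (2:ℝ)^(1/4:ℝ) - 1 with hδ
  have h1 : 0 < δ := by
    have := Real.one_lt_rpow (x := 2) (z := 1/4) (by norm_num) (by norm_num)
    linarith
  have h2 : δ ≤ 1 := by
    have := Real.rpow_le_rpow_of_exponent_le (x := 2) (y := 1/4) (z := 1) (by norm_num) (by norm_num)
    rw [Real.rpow_one] at this
    linarith
  have hM1 : 1 ≤ 12 / δ := by rw [le_div_iff₀ h1]; linarith
  refine ⟨(12/δ)^(24^4), by positivity, fun n hn => ?_⟩
  refine (cf_le_aux (12/δ) hM1 ?_ n hn).trans ?_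
  · intro k
    have h3 := one_add_mul_le_pow (a := δ) (by linarith) k
    have h4 : (2:ℝ)^(1/4:ℝ) = 1 + δ := by rw [hδ]; ring
    rw [h4]
    calc 12 * ((k:ℝ)+1) ≤ 12 / δ * (1 + k * δ) := by
          rw [div_mul_eq_mul_div, le_div_iff₀ h1]; nlinarith
      _ ≤ _ := by gcongr
  · gcongr
    calc _ ≤ (Finset.range (24^4)).card := Finset.card_le_card (fun p hp => by
            simp only [Finset.mem_filter] at hp
            exact Finset.mem_range.2 hp.2)
      _ = _ := Finset.card_range _

lemma gloc_partial {p : ℕ} (hp : p.Prime) {N : ℕ} (k : ℕ) (h : p^(k+1) ∣ N) :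
    ∑ e ∈ Finset.range (k+2), gloc p e N = (p:ℝ)/(p-1) - (p:ℝ) / ((p:ℝ)^k * (((p:ℝ)-1)^2*(p+1))) := by
  have hp1 : (1:ℝ) < p := by exact_mod_cast hp.one_lt
  have hp0 : (p:ℝ) ≠ 0 := by linarith
  have hp2 : (p:ℝ) - 1 ≠ 0 := by linarith
  have hp3 : (p:ℝ) + 1 ≠ 0 := by linarith
  induction k with
  | zero =>
    have h1 : p ∣ N := by simpa using h
    have h2 : ¬ (p:ℤ) ∣ (N:ℤ) - 1 := by
      intro h3
      have h4 : (p:ℤ) ∣ 1 := by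
        have := dvd_sub (Int.natCast_dvd_natCast.2 h1) h3
        simpa using this
      have := Int.natCast_dvd_natCast.1 (by simpa using h4 : (p:ℤ) ∣ ((1:ℕ):ℤ))
      exact hp.one_lt.ne' (Nat.dvd_one.1 this)
    simp [Finset.sum_range_succ, gloc, h1, h2]
    field_simp
    ring
  | succ k ih =>
    rw [Finset.sum_range_succ, ih ((pow_dvd_pow _ (by omega)).trans h)]
    have h2 : p^(k+1) ∣ N := (pow_dvd_pow _ (by omega)).trans h
    have h : p^(k+2) ∣ N := h
    simp only [gloc, show k + 2 - 1 = k+1 by omega, h, h2,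
      show k + 2 ≠ 0 by omega, show k + 2 ≠ 1 by omega, if_false, if_true]
    field_simp
    ring

lemma gloc_tsum {p : ℕ} (hp : p.Prime) {N : ℕ} (hN : N ≠ 0) :
    (∑' e, gloc p e N) * (if p ∣ N then (1 - (p:ℝ)⁻¹) else 1) = Kfactor N p := by
  have hp1 : (1:ℝ) < p := by exact_mod_cast hp.one_lt
  have hp0 : (p:ℝ) ≠ 0 := by linarith
  have hp2 : (p:ℝ) - 1 ≠ 0 := by linarith
  have hp3 : (p:ℝ) + 1 ≠ 0 := by linarith
  by_cases h1 : p ∣ N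
  · obtain ⟨k, hk⟩ : ∃ k, N.factorization p = k + 1 :=
      Nat.exists_eq_succ_of_ne_zero (hp.factorization_pos_of_dvd hN h1).ne'
    have hd : ∀ j, p^j ∣ N ↔ j ≤ k + 1 := fun j => by
      rw [hp.pow_dvd_iff_le_factorization hN, hk]
    rw [tsum_eq_sum (s := Finset.range (k+3))]
    · rw [Finset.sum_range_succ, gloc_partial hp k ((hd _).2 le_rfl)]
      simp only [gloc, Kfactor, hd, h1, hk, show k + 2 - 1 = k+1 by omega, show ¬ k + 2 ≤ k + 1 by omega,
        show k + 2 ≠ 0 by omega, show k + 2 ≠ 1 by omega, if_false, if_true, le_refl]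
      field_simp
      ring
    · intro b hb
      have hb : k + 3 ≤ b := by simpa using hb
      simp only [gloc, hd, show ¬ b ≤ k + 1 by omega, show ¬ b - 1 ≤ k + 1 by omega, show b ≠ 0 by omega,
        show b ≠ 1 by omega, if_false]
      simp
  · rw [tsum_eq_sum (s := Finset.range 2)]
    · simp only [Finset.sum_range_succ, Finset.sum_range_zero, gloc, Kfactor, h1, if_false, if_true, one_ne_zero]
      split_ifs <;> field_simp <;> ring
    · intro b hb
      have hb : 2 ≤ b := by simp at hb; omega
      have h2 : ¬ p^b ∣ N := fun h => h1 ((dvd_pow_self p (by omega)).trans h)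
      have h3 : ¬ p^(b-1) ∣ N := fun h => h1 ((dvd_pow_self p (by omega)).trans h)
      simp [gloc, h2, h3, show b ≠ 0 by omega, show b ≠ 1 by omega]

lemma gam_summable (N : ℕ) (hN : N ≠ 0) : Summable (fun n => ‖gam n N‖) := by
  obtain ⟨A, hA, h⟩ := cf_le
  refine Summable.of_nonneg_of_le (fun _ => norm_nonneg _) (f := fun n : ℕ => A * N * ((n:ℝ)^(-(7/4:ℝ)))) ?_ ?_
  · intro n
    by_cases hn : n = 0
    · simp only [hn, gam_zero, norm_zero]; positivity
    have hn' : (0:ℝ) < n := by exact_mod_cast Nat.pos_of_ne_zero hn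
    rw [Real.norm_eq_abs]
    refine (gam_bound hn N).trans ?_
    have h1 : (12:ℝ) ^ n.primeFactors.card ≤ A * (n:ℝ)^(1/4:ℝ) := by
      refine le_trans ?_ (h n hn)
      unfold cf
      have : (1:ℝ) ≤ n.divisors.card := by
        exact_mod_cast Finset.card_pos.2 ⟨1, by simp [hn]⟩
      exact le_mul_of_one_le_right (by positivity) this
    have h2 : (Nat.gcd n N : ℝ) ≤ N := by
      exact_mod_cast Nat.gcd_le_right _ (Nat.pos_of_ne_zero hN)
    calc _ ≤ (A * (n:ℝ)^(1/4:ℝ)) * N / (n:ℝ)^2 := by gcongr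
      _ = A * N * ((n:ℝ)^(1/4:ℝ) / (n:ℝ)^(2:ℝ)) := by
        rw [Real.rpow_two]; ring
      _ = _ := by rw [← Real.rpow_sub hn']; norm_num
  · apply Summable.mul_left
    rw [Real.summable_nat_rpow]
    norm_num

lemma Kstar_eq (N : ℕ) (hN : N ≠ 0) : Kstar N = ∑' n, gam n N := by
  have h1 := EulerProduct.eulerProduct_hasProd (f := fun n => gam n N) (gam_one N) (fun h => gam_mul N h)
    (gam_summable N hN) (gam_zero N)
  have h2 : HasProd (fun p : Nat.Primes => if (p:ℕ) ∣ N then (1 - ((p:ℕ):ℝ)⁻¹) else 1)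
      ((Nat.totient N : ℝ) / N) := by
    have h3 : (Nat.totient N : ℝ) / N = ∏ p ∈ N.primeFactors, (1 - (p:ℝ)⁻¹) := by
      have := Nat.totient_eq_mul_prod_factors N
      have h4 : (Nat.totient N : ℝ) = N * ∏ p ∈ N.primeFactors, (1 - (p:ℝ)⁻¹) := by
        have h5 := congrArg (Rat.cast : ℚ → ℝ) this
        push_cast at h5
        exact h5
      rw [h4]
      have : (N:ℝ) ≠ 0 := by exact_mod_cast hN
      field_simp
    have h5 : (Nat.totient N : ℝ) / N = ∏ p ∈ N.primeFactors.subtype Nat.Prime,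
        (if ((p : Nat.Primes):ℕ) ∣ N then (1 - ((p:ℕ):ℝ)⁻¹) else 1) := by
      rw [h3, Finset.prod_subtype_of_mem (f := fun p : ℕ => if p ∣ N then (1 - (p:ℝ)⁻¹) else 1)
        (fun p hp => Nat.prime_of_mem_primeFactors hp)]
      refine Finset.prod_congr rfl fun p hp => ?_
      rw [if_pos (Nat.dvd_of_mem_primeFactors hp)]
    rw [h5]
    apply hasProd_prod_of_ne_finset_one
    intro p hp
    rw [if_neg]
    intro h
    apply hp
    refine Finset.mem_subtype.2 ?_
    exact Nat.mem_primeFactors.2 ⟨p.2, h, hN⟩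
  have h6 := h1.mul h2
  have h7 : K N = (∑' n, gam n N) * ((Nat.totient N : ℝ) / N) := by
    unfold K
    rw [← h6.tprod_eq]
    refine tprod_congr fun p => ?_
    rw [← gloc_tsum p.2 hN]
    simp_rw [gam_prime_pow p.2]
  have h8 : (N:ℝ) ≠ 0 := by exact_mod_cast hN
  have h9 : (Nat.totient N : ℝ) ≠ 0 := by
    exact_mod_cast (Nat.totient_pos.2 (Nat.pos_of_ne_zero hN)).ne'
  rw [Kstar, h7]
  field_simp

lemma main_nat : ∃ B : ℝ, 0 ≤ B ∧ ∀ X : ℕ, |(∑ N ∈ Finset.Icc 1 X, Kstar N) - X| ≤ B * Real.sqrt X := by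
  obtain ⟨A, hA, hcf⟩ := cf_le
  have hs : Summable (fun n : ℕ => (n:ℝ)^(-(5/4:ℝ))) := by
    rw [Real.summable_nat_rpow]
    norm_num
  refine ⟨A * ∑' n : ℕ, (n:ℝ)^(-(5/4:ℝ)), mul_nonneg hA.le (tsum_nonneg fun n => by positivity), fun X => ?_⟩
  have e1 : ∑ N ∈ Finset.Icc 1 X, Kstar N = ∑' n, ∑ i ∈ Finset.range X, gam n (i+1) := by
    rw [Summable.tsum_finsetSum (fun i _ => (gam_summable (i+1) (by omega)).of_norm)]
    rw [Finset.range_eq_Ico, Finset.sum_Ico_add' (fun N => ∑' n, gam n N) 0 X 1]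
    refine Finset.sum_congr ?_ fun N hN => ?_
    · ext; simp
    · exact Kstar_eq N (by have := Finset.mem_Icc.1 hN; omega)
  have hsum : Summable (fun n => ∑ i ∈ Finset.range X, gam n (i+1)) :=
    summable_sum (fun i _ => (gam_summable (i+1) (by omega)).of_norm)
  have e2 : (X:ℝ) = ∑' n : ℕ, if n = 1 then (X:ℝ) else 0 := by simp
  have hsum2 : Summable (fun n : ℕ => if n = 1 then (X:ℝ) else 0) :=
    summable_of_ne_finset_zero (s := {1}) (fun b hb => by simp at hb; simp [hb])
  have hb : ∀ n : ℕ, ‖(∑ i ∈ Finset.range X, gam n (i+1)) - (if n = 1 then (X:ℝ) else 0)‖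
      ≤ A * Real.sqrt X * (n:ℝ)^(-(5/4:ℝ)) := by
    intro n
    rcases Nat.lt_or_ge 1 n with hn | hn
    · rw [if_neg (by omega), sub_zero, Real.norm_eq_abs]
      have hn' : (0:ℝ) < n := by exact_mod_cast (by omega : 0 < n)
      refine (gam_sum_final hn X).trans ?_
      calc _ ≤ Real.sqrt X * Real.sqrt n * (A * (n:ℝ)^(1/4:ℝ)) / (n:ℝ)^2 := by
            gcongr; exact hcf n (by omega)
        _ = A * Real.sqrt X * ((n:ℝ)^(1/2:ℝ) * (n:ℝ)^(1/4:ℝ) / (n:ℝ)^(2:ℝ)) := by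
            rw [Real.rpow_two, Real.sqrt_eq_rpow (n:ℝ)]; ring
        _ = _ := by rw [← Real.rpow_add hn', ← Real.rpow_sub hn']; norm_num
    · have : n = 0 ∨ n = 1 := by omega
      rcases this with rfl | rfl
      · simp only [gam_zero]; simp
      · simp only [gam_one]; simp; positivity
  calc _ = |∑' n : ℕ, ((∑ i ∈ Finset.range X, gam n (i+1)) - (if n = 1 then (X:ℝ) else 0))| := by
        rw [hsum.tsum_sub hsum2, ← e1, ← e2]
    _ ≤ ∑' n : ℕ, A * Real.sqrt X * (n:ℝ)^(-(5/4:ℝ)) := by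
        rw [← Real.norm_eq_abs]
        exact tsum_of_norm_bounded (hs.mul_left _).hasSum hb
    _ = _ := by rw [tsum_mul_left]; ring

theorem stmt_8 :
    ∃ C : ℝ, ∀ x : ℝ, 2 ≤ x →
      |(∑ N ∈ Finset.Icc 1 ⌊x⌋₊, Kstar N) - x| ≤ C * x / Real.log x := by
  obtain ⟨B, hB, h⟩ := main_nat
  refine ⟨2 * (B + 1), fun x hx => ?_⟩
  have hx0 : 0 < x := by linarith
  have hlog : 0 < Real.log x := Real.log_pos (by linarith)
  have h1 := h ⌊x⌋₊
  have h2 : Real.sqrt (⌊x⌋₊ : ℝ) ≤ Real.sqrt x := Real.sqrt_le_sqrt (Nat.floor_le hx0.le)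
  have h3 : |((⌊x⌋₊ : ℕ):ℝ) - x| ≤ Real.sqrt x := by
    have a := Nat.floor_le hx0.le
    have b := Nat.lt_floor_add_one x
    have c : 1 ≤ Real.sqrt x := Real.one_le_sqrt.2 (by linarith)
    rw [abs_le]; constructor <;> linarith
  have h4 : |(∑ N ∈ Finset.Icc 1 ⌊x⌋₊, Kstar N) - x| ≤ (B + 1) * Real.sqrt x := by
    refine (abs_sub_le _ ((⌊x⌋₊ : ℕ):ℝ) _).trans ?_
    have := mul_le_mul_of_nonneg_left h2 hB
    linarith
  refine h4.trans ?_
  rw [le_div_iff₀ hlog]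
  have h5 : Real.log x ≤ 2 * Real.sqrt x := by
    have h6 := Real.log_le_sub_one_of_pos (Real.sqrt_pos.2 hx0)
    rw [Real.log_sqrt hx0.le] at h6
    linarith
  have h7 : Real.sqrt x * Real.sqrt x = x := Real.mul_self_sqrt hx0.le
  calc (B + 1) * Real.sqrt x * Real.log x ≤ (B + 1) * Real.sqrt x * (2 * Real.sqrt x) := by gcongr
    _ = 2 * (B + 1) * (Real.sqrt x * Real.sqrt x) := by ring
    _ = _ := by rw [h7]
end

section
/- ∑_{N ≤ x, N odd} K*(N) = x/3 + O(x/log x) for x ≥ 2, where K*(N) = K(N)·N/φ(N) with K as in Definition 1. -/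
noncomputable def fK (N p : ℕ) : ℝ := Kfactor N p * (if p ∣ N then (p:ℝ)/((p:ℝ)-1) else 1)

lemma fK_hasSum (N p : ℕ) (hN : 1 ≤ N) (hp : p.Prime) (hp3 : 3 ≤ p) :
    HasSum (fun k : ℕ => (1 / ((p:ℝ)^k * ((p:ℝ)-1))) * (if p^(k+1) ∣ N then (1:ℝ) else 0))
      (fK N p - (1 - 1/((p:ℝ)-1)^2)
        - (p:ℝ)/(((p:ℝ)-1)^2*((p:ℝ)+1)) * (if N ≡ 1 [MOD p] then (1:ℝ) else 0)) := by
  have hpR : (3:ℝ) ≤ p := by exact_mod_cast hp3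
  have h1 : (p:ℝ) - 1 ≠ 0 := by linarith
  have h2 : (p:ℝ) + 1 ≠ 0 := by linarith
  have h3 : (p:ℝ) ≠ 0 := by linarith
  have hdiv : ((p:ℤ) ∣ (N:ℤ) - 1) ↔ N ≡ 1 [MOD p] := by
    rw [Nat.ModEq.comm, Nat.modEq_iff_dvd]; norm_num
  have hfin : HasSum (fun k : ℕ => (1 / ((p:ℝ)^k * ((p:ℝ)-1))) * (if p^(k+1) ∣ N then (1:ℝ) else 0))
      (∑ k ∈ Finset.range (N.factorization p), 1 / ((p:ℝ)^k * ((p:ℝ)-1))) := by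
    have := hasSum_sum_of_ne_finset_zero (f := fun k : ℕ => (1 / ((p:ℝ)^k * ((p:ℝ)-1))) * (if p^(k+1) ∣ N then (1:ℝ) else 0)) (s := Finset.range (N.factorization p)) (L := SummationFilter.unconditional ℕ) (by
      intro k hk
      rw [Finset.mem_range] at hk
      rw [if_neg (fun h => by
        have := (hp.pow_dvd_iff_le_factorization (by omega)).1 h
        omega), mul_zero])
    convert this using 1
    apply Finset.sum_congr rfl
    intro k hk
    rw [Finset.mem_range] at hk
    rw [if_pos ((hp.pow_dvd_iff_le_factorization (by omega)).2 (by omega)), mul_one]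
  have hgeo : ∀ v : ℕ, (∑ k ∈ Finset.range v, 1 / ((p:ℝ)^k * ((p:ℝ)-1))) = (1 - 1/(p:ℝ)^v) * p / ((p:ℝ)-1)^2 := by
    intro v
    induction v with
    | zero => simp
    | succ v ih => rw [Finset.sum_range_succ, ih]; field_simp; ring
  convert hfin using 1
  rw [hgeo]
  unfold fK Kfactor
  by_cases hpN : p ∣ N
  · have hn1 : ¬ N ≡ 1 [MOD p] := by
      intro h
      have := (h.dvd_iff (dvd_refl p)).1 hpN
      have := Nat.le_of_dvd one_pos this
      omega
    simp only [hpN, hn1, if_true, if_false]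
    field_simp
    ring
  · have : N.factorization p = 0 := Nat.factorization_eq_zero_of_not_dvd hpN
    simp only [hpN, hdiv, if_false, this]
    by_cases h : N ≡ 1 [MOD p]
    · simp only [h, if_true]
      field_simp
      ring
    · simp only [h, if_false]
      field_simp
      ring

lemma fK_bound (N p : ℕ) (hN : 1 ≤ N) (hp : p.Prime) (hp3 : 3 ≤ p) :
    |fK N p - 1| ≤ 1/((p:ℝ)-1)^2 + (if p ∣ N then 1/((p:ℝ)-1) else 0) := by
  have hpR : (3:ℝ) ≤ p := by exact_mod_cast hp3
  have h1 : (0:ℝ) < (p:ℝ) - 1 := by linarith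
  have h2 : (0:ℝ) < (p:ℝ) + 1 := by linarith
  have h3 : (0:ℝ) < (p:ℝ) := by linarith
  unfold fK Kfactor
  by_cases hpN : p ∣ N
  · simp only [hpN, if_true]
    have hv : 1 ≤ N.factorization p := (hp.dvd_iff_one_le_factorization (by omega)).1 hpN
    obtain ⟨w, hw⟩ := Nat.exists_eq_add_of_le' hv
    rw [hw]
    have e : (1 - 1 / ((p:ℝ) ^ (w+1) * ((p:ℝ) - 1))) * ((p:ℝ) / (p - 1)) - 1 = 1/((p:ℝ)-1) - 1/(p:ℝ)^w * (1/((p:ℝ)-1)^2) := by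
      field_simp; ring
    rw [e]
    have hq : 1/(p:ℝ)^w ≤ 1 := by
      rw [div_le_one (by positivity)]; exact one_le_pow₀ (by linarith)
    have hq0 : 0 ≤ 1/(p:ℝ)^w := by positivity
    have hc : 0 < 1/((p:ℝ)-1)^2 := by positivity
    have hd : 0 < 1/((p:ℝ)-1) := by positivity
    rw [abs_le]
    constructor <;> nlinarith
  · simp only [hpN, if_false, mul_one, add_zero]
    rw [sub_sub_cancel_left, abs_neg, abs_of_nonneg (by split_ifs <;> positivity)]
    rw [div_le_div_iff₀ (by positivity) (by positivity)]
    split_ifs <;> nlinarith [sq_nonneg ((p:ℝ)-1), mul_pos h1 h1, mul_pos (mul_pos h1 h1) h3]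

lemma fK_nonneg (N p : ℕ) (hN : 1 ≤ N) (hp : p.Prime) (hp3 : 3 ≤ p) : 0 ≤ fK N p := by
  have hs := fK_hasSum N p hN hp hp3
  have hpR : (3:ℝ) ≤ p := by exact_mod_cast hp3
  have h1 : (0:ℝ) < (p:ℝ) - 1 := by linarith
  have := hs.nonneg (fun k => by split_ifs <;> positivity)
  have h4 : 1/((p:ℝ)-1)^2 ≤ 1 := by
    rw [div_le_one (by positivity)]; nlinarith
  have h5 : 0 ≤ (p:ℝ)/(((p:ℝ)-1)^2*((p:ℝ)+1)) * (if N ≡ 1 [MOD p] then (1:ℝ) else 0) := by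
    split_ifs <;> positivity
  linarith

lemma Kfactor_bound (N p : ℕ) (hN : 1 ≤ N) (hp : p.Prime) :
    |Kfactor N p - 1| ≤ 4 * (1 / (p:ℝ)^2) := by
  have hpR : (2:ℝ) ≤ p := by exact_mod_cast hp.two_le
  have h1 : (0:ℝ) < (p:ℝ) - 1 := by linarith
  have h2 : (0:ℝ) < (p:ℝ) + 1 := by linarith
  have h3 : (0:ℝ) < (p:ℝ) := by linarith
  have key : 1/((p:ℝ)-1)^2 ≤ 4 * (1 / (p:ℝ)^2) := by
    rw [mul_one_div, div_le_div_iff₀ (by positivity) (by positivity)]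
    nlinarith
  refine le_trans ?_ key
  unfold Kfactor
  by_cases hpN : p ∣ N
  · simp only [hpN, if_true]
    have hv : 1 ≤ N.factorization p := (hp.dvd_iff_one_le_factorization (by omega)).1 hpN
    rw [sub_sub_cancel_left, abs_neg, abs_of_nonneg (by positivity)]
    apply one_div_le_one_div_of_le (by positivity)
    have : (p:ℝ)^1 ≤ (p:ℝ)^(N.factorization p) := pow_le_pow_right₀ (by linarith) hv
    nlinarith
  · simp only [hpN, if_false]
    rw [sub_sub_cancel_left, abs_neg, abs_of_nonneg (by split_ifs <;> positivity)]
    rw [div_le_div_iff₀ (by positivity) (by positivity)]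
    split_ifs <;> nlinarith [sq_nonneg ((p:ℝ)-1), mul_pos h1 h1, mul_pos (mul_pos h1 h1) h3]

lemma base_count (X m r : ℕ) (hm : 0 < m) :
    |(((Finset.Ioc 0 X).filter (fun N => N ≡ r [MOD m])).card : ℝ) - (X:ℝ)/m| ≤ 1 := by
  have h := Nat.Ioc_filter_modEq_card 0 X hm r
  have hmQ : (0:ℚ) < m := by exact_mod_cast hm
  have hle : ((0:ℕ) - (r:ℚ)) / (m:ℚ) ≤ ((X:ℚ) - r)/m := by
    apply div_le_div_of_nonneg_right _ hmQ.le
    have : (0:ℚ) ≤ X := by positivity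
    push_cast; linarith
  rw [max_eq_left (by have := Int.floor_le_floor hle; omega)] at h
  have hX : ((X:ℚ) - r)/m - ((0:ℕ) - (r:ℚ)) / (m:ℚ) = (X:ℚ)/m := by
    push_cast; ring
  have a1 := Int.floor_le (((X:ℚ) - r)/m)
  have a2 := Int.lt_floor_add_one (((X:ℚ) - r)/m)
  have a3 := Int.floor_le (((0:ℕ) - (r:ℚ)) / (m:ℚ))
  have a4 := Int.lt_floor_add_one (((0:ℕ) - (r:ℚ)) / (m:ℚ))
  have h' : (((Finset.Ioc 0 X).filter (fun N => N ≡ r [MOD m])).card : ℚ)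
      = (⌊((X:ℚ) - r)/m⌋ : ℚ) - (⌊((0:ℕ) - (r:ℚ)) / (m:ℚ)⌋ : ℚ) := by exact_mod_cast h
  have hq : |(((Finset.Ioc 0 X).filter (fun N => N ≡ r [MOD m])).card : ℚ) - (X:ℚ)/m| ≤ 1 := by
    rw [h', abs_le]
    constructor <;> linarith
  have hq' := (Rat.cast_le (K := ℝ)).2 hq
  push_cast at hq'
  exact hq'

noncomputable def TT (S : Finset ℕ) (X m r : ℕ) : ℝ :=
  ∑ N ∈ Finset.Ioc 0 X, (if N ≡ r [MOD m] then (1:ℝ) else 0) * ∏ p ∈ S, fK N p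

lemma crt_ind (m q r s : ℕ) (h : m.Coprime q) : ∃ t : ℕ, ∀ N : ℕ,
    (if N ≡ r [MOD m] then (1:ℝ) else 0) * (if N ≡ s [MOD q] then (1:ℝ) else 0)
      = if N ≡ t [MOD m*q] then (1:ℝ) else 0 := by
  obtain ⟨t, ht1, ht2⟩ := Nat.chineseRemainder h r s
  refine ⟨t, fun N => ?_⟩
  have : N ≡ t [MOD m*q] ↔ N ≡ r [MOD m] ∧ N ≡ s [MOD q] := by
    rw [← Nat.modEq_and_modEq_iff_modEq_mul h]
    exact ⟨fun ⟨a, b⟩ => ⟨a.trans ht1, b.trans ht2⟩, fun ⟨a, b⟩ => ⟨a.trans ht1.symm, b.trans ht2.symm⟩⟩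
  by_cases h1 : N ≡ r [MOD m] <;> by_cases h2 : N ≡ s [MOD q] <;> simp [this, h1, h2]

lemma TT_bound (X : ℕ) (S : Finset ℕ) : (∀ p ∈ S, p.Prime ∧ 3 ≤ p) →
    ∀ m r : ℕ, 0 < m → (∀ p ∈ S, m.Coprime p) →
    |TT S X m r - (X:ℝ)/m| ≤ ∏ p ∈ S, (1 + 2/((p:ℝ)-1)) := by
  induction S using Finset.induction_on with
  | empty =>
    intro _ m r hm _
    have := base_count X m r hm
    simpa [TT, Finset.sum_ite] using this
  | insert p S hpS ih =>
    intro hS m r hm hco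
    obtain ⟨hp, hp3⟩ := hS p (Finset.mem_insert_self _ _)
    have hS' : ∀ p ∈ S, p.Prime ∧ 3 ≤ p := fun q hq => hS q (Finset.mem_insert_of_mem hq)
    have hco' : ∀ p ∈ S, m.Coprime p := fun q hq => hco q (Finset.mem_insert_of_mem hq)
    have hmp : m.Coprime p := hco p (Finset.mem_insert_self _ _)
    have ih := ih hS'
    have hpq : ∀ q ∈ S, p.Coprime q := fun q hq =>
      (Nat.coprime_primes hp (hS' q hq).1).2 (fun h => hpS (h ▸ hq))
    set B := ∏ p ∈ S, (1 + 2/((p:ℝ)-1)) with hB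
    have hB0 : 0 ≤ B := Finset.prod_nonneg (fun q hq => by
      have : (3:ℝ) ≤ q := by exact_mod_cast (hS' q hq).2
      have : (0:ℝ) < (q:ℝ) - 1 := by linarith
      positivity)
    have hpR : (3:ℝ) ≤ p := by exact_mod_cast hp3
    have h1 : (0:ℝ) < (p:ℝ) - 1 := by linarith
    have h2 : (0:ℝ) < (p:ℝ) + 1 := by linarith
    have h3 : (0:ℝ) < (p:ℝ) := by linarith
    have hmR : (0:ℝ) < m := by exact_mod_cast hm
    -- CRT
    obtain ⟨t1, ht1⟩ := crt_ind m p r 1 hmp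
    choose t ht using fun k : ℕ => crt_ind m (p^(k+1)) r 0 (hmp.pow_right (k+1))
    have e0 := ih m r hm hco'
    have e1 := ih (m*p) t1 (by positivity) (fun q hq => Nat.Coprime.mul_left (hco' q hq) (hpq q hq))
    have ek : ∀ k, |TT S X (m*p^(k+1)) (t k) - (X:ℝ)/((m*p^(k+1) : ℕ):ℝ)| ≤ B := fun k =>
      ih (m*p^(k+1)) (t k) (by positivity)
        (fun q hq => Nat.Coprime.mul_left (hco' q hq) ((hpq q hq).pow_left _))
    set a : ℝ := 1 - 1/((p:ℝ)-1)^2 with ha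
    set b : ℝ := (p:ℝ)/(((p:ℝ)-1)^2*((p:ℝ)+1)) with hb
    have hsum : HasSum (fun k : ℕ => (1 / ((p:ℝ)^k * ((p:ℝ)-1))) * TT S X (m*p^(k+1)) (t k))
        (TT (insert p S) X m r - a * TT S X m r - b * TT S X (m*p) t1) := by
      have key : ∀ N ∈ Finset.Ioc 0 X, HasSum (fun k : ℕ =>
          ((if N ≡ r [MOD m] then (1:ℝ) else 0) * ∏ p ∈ S, fK N p) *
            ((1 / ((p:ℝ)^k * ((p:ℝ)-1))) * (if p^(k+1) ∣ N then (1:ℝ) else 0)))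
          (((if N ≡ r [MOD m] then (1:ℝ) else 0) * ∏ p ∈ S, fK N p) *
            (fK N p - a - b * (if N ≡ 1 [MOD p] then (1:ℝ) else 0))) := by
        intro N hN
        exact (fK_hasSum N p (Finset.mem_Ioc.1 hN).1 hp hp3).mul_left _
      have := hasSum_sum key
      convert this using 1
      · funext k
        unfold TT
        rw [Finset.mul_sum]
        apply Finset.sum_congr rfl
        intro N _
        rw [← ht k N]
        have : (if N ≡ 0 [MOD p^(k+1)] then (1:ℝ) else 0) = (if p^(k+1) ∣ N then (1:ℝ) else 0) := by
          simp only [Nat.modEq_zero_iff_dvd]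
        rw [this]; ring
      · unfold TT
        rw [Finset.mul_sum, Finset.mul_sum, ← Finset.sum_sub_distrib, ← Finset.sum_sub_distrib]
        apply Finset.sum_congr rfl
        intro N _
        rw [← ht1 N, Finset.prod_insert hpS]; ring
    have hg1 : HasSum (fun k : ℕ => 1 / ((p:ℝ)^k * ((p:ℝ)-1))) ((p:ℝ)/((p:ℝ)-1)^2) := by
      have := (hasSum_geometric_of_lt_one (r := (p:ℝ)⁻¹) (by positivity)
        (inv_lt_one_of_one_lt₀ (by linarith))).mul_right (1/((p:ℝ)-1))
      have ef : (fun k : ℕ => 1 / ((p:ℝ)^k * ((p:ℝ)-1))) = fun k => (p:ℝ)⁻¹^k * (1/((p:ℝ)-1)) := by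
        funext k; rw [inv_pow]; field_simp
      have h4 : 1 - (p:ℝ)⁻¹ = ((p:ℝ)-1)/p := by field_simp
      have ev : (p:ℝ)/((p:ℝ)-1)^2 = (1 - (p:ℝ)⁻¹)⁻¹ * (1/((p:ℝ)-1)) := by
        rw [h4]; field_simp
      rw [ef, ev]; exact this
    have hg2 : HasSum (fun k : ℕ => 1 / ((p:ℝ)^k * ((p:ℝ)-1)) * ((X:ℝ)/((m*p^(k+1) : ℕ):ℝ)))
        ((X:ℝ)/m * (p/(((p:ℝ)-1)^2*((p:ℝ)+1)))) := by
      have hp2 : (0:ℝ) < (p:ℝ)^2 - 1 := by nlinarith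
      have := (hasSum_geometric_of_lt_one (r := ((p:ℝ)^2)⁻¹) (by positivity)
        (inv_lt_one_of_one_lt₀ (by nlinarith))).mul_right ((X:ℝ)/m/(((p:ℝ)-1)*p))
      have ef : (fun k : ℕ => 1 / ((p:ℝ)^k * ((p:ℝ)-1)) * ((X:ℝ)/((m*p^(k+1) : ℕ):ℝ)))
          = fun k => ((p:ℝ)^2)⁻¹^k * ((X:ℝ)/m/(((p:ℝ)-1)*p)) := by
        funext k; rw [inv_pow]; push_cast; field_simp; ring
      have h4 : 1 - ((p:ℝ)^2)⁻¹ = ((p:ℝ)-1)*((p:ℝ)+1)/(p:ℝ)^2 := by field_simp; ring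
      have ev : ((X:ℝ)/m * (p/(((p:ℝ)-1)^2*((p:ℝ)+1))))
          = (1 - ((p:ℝ)^2)⁻¹)⁻¹ * ((X:ℝ)/m/(((p:ℝ)-1)*p)) := by
        rw [h4]; field_simp
      rw [ef, ev]; exact this
    have hup := hasSum_le (fun k => by
      have := (abs_le.1 (ek k)).2
      have hc : (0:ℝ) ≤ 1 / ((p:ℝ)^k * ((p:ℝ)-1)) := by positivity
      show (1 / ((p:ℝ)^k * ((p:ℝ)-1))) * TT S X (m*p^(k+1)) (t k) ≤
        1 / ((p:ℝ)^k * ((p:ℝ)-1)) * ((X:ℝ)/((m*p^(k+1) : ℕ):ℝ)) + 1 / ((p:ℝ)^k * ((p:ℝ)-1)) * B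
      rw [← mul_add]
      exact mul_le_mul_of_nonneg_left (by linarith) hc) hsum (hg2.add (hg1.mul_right B))
    have hlo := hasSum_le (fun k => by
      have := (abs_le.1 (ek k)).1
      have hc : (0:ℝ) ≤ 1 / ((p:ℝ)^k * ((p:ℝ)-1)) := by positivity
      show 1 / ((p:ℝ)^k * ((p:ℝ)-1)) * ((X:ℝ)/((m*p^(k+1) : ℕ):ℝ)) - 1 / ((p:ℝ)^k * ((p:ℝ)-1)) * B
        ≤ (1 / ((p:ℝ)^k * ((p:ℝ)-1))) * TT S X (m*p^(k+1)) (t k)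
      rw [← mul_sub]
      exact mul_le_mul_of_nonneg_left (by linarith) hc) (hg2.sub (hg1.mul_right B)) hsum
    have ha0 : 0 ≤ a := by
      rw [ha, sub_nonneg, div_le_one (by positivity)]; nlinarith
    have hb0 : 0 ≤ b := by rw [hb]; positivity
    have A0 := mul_le_mul_of_nonneg_left (abs_le.1 e0).1 ha0
    have A0' := mul_le_mul_of_nonneg_left (abs_le.1 e0).2 ha0
    have A1 := mul_le_mul_of_nonneg_left (abs_le.1 e1).1 hb0
    have A1' := mul_le_mul_of_nonneg_left (abs_le.1 e1).2 hb0
    have main : a * ((X:ℝ)/m) + b * ((X:ℝ)/((m*p:ℕ):ℝ)) + (X:ℝ)/m * b = (X:ℝ)/m := by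
      rw [ha, hb]; push_cast; field_simp; ring
    have hBB : a * B + b * B + (p:ℝ)/((p:ℝ)-1)^2 * B ≤ (1 + 2/((p:ℝ)-1)) * B := by
      rw [← add_mul, ← add_mul]
      apply mul_le_mul_of_nonneg_right _ hB0
      have e : (1 + 2/((p:ℝ)-1)) - (a + b + (p:ℝ)/((p:ℝ)-1)^2) = (1 - p/(((p:ℝ)-1)*((p:ℝ)+1)))/((p:ℝ)-1) := by
        rw [ha, hb]; field_simp; ring
      have : p/(((p:ℝ)-1)*((p:ℝ)+1)) ≤ 1 := by
        rw [div_le_one (by positivity)]; nlinarith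
      have : 0 ≤ (1 - p/(((p:ℝ)-1)*((p:ℝ)+1)))/((p:ℝ)-1) := div_nonneg (by linarith) h1.le
      linarith
    rw [Finset.prod_insert hpS, ← hB, abs_le]
    rw [← hb] at hup hlo
    constructor <;> nlinarith

lemma prod_B (z : ℕ) (hz : 2 ≤ z) :
    ∏ p ∈ (Finset.Ioc 2 z).filter Nat.Prime, (1 + 2/((p:ℝ)-1)) ≤ (z:ℝ)^2 := by
  have h0 : ∀ p ∈ Finset.Ioc 2 z, 1 ≤ 1 + 2/((p:ℝ)-1) := by
    intro p hp
    have : (2:ℝ) < p := by exact_mod_cast (Finset.mem_Ioc.1 hp).1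
    have : (0:ℝ) < (p:ℝ) - 1 := by linarith
    have : 0 < 2/((p:ℝ)-1) := by positivity
    linarith
  have h1 : ∏ p ∈ (Finset.Ioc 2 z).filter Nat.Prime, (1 + 2/((p:ℝ)-1))
      ≤ ∏ p ∈ Finset.Ioc 2 z, (1 + 2/((p:ℝ)-1)) :=
    Finset.prod_le_prod_of_subset_of_one_le (Finset.filter_subset _ _)
      (fun i hi => by linarith [h0 i (Finset.filter_subset _ _ hi)]) (fun i hi _ => h0 i hi)
  have h2 : ∏ p ∈ Finset.Ioc 2 z, (1 + 2/((p:ℝ)-1)) = (z:ℝ)*(z+1)/6 := by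
    clear h0 h1
    induction z, hz using Nat.le_induction with
    | base => norm_num
    | succ n hn ih =>
      rw [Finset.prod_Ioc_succ_top (by omega), ih]
      have : (2:ℝ) ≤ n := by exact_mod_cast hn
      have : (n:ℝ) ≠ 0 := by linarith
      push_cast
      rw [add_sub_cancel_right]
      field_simp; ring
  have : (2:ℝ) ≤ z := by exact_mod_cast hz
  rw [h2] at h1
  nlinarith

lemma K_tendsto (N : ℕ) (hN : 1 ≤ N) :
    Filter.Tendsto (fun n : ℕ => ∏ p ∈ (Finset.range n).filter Nat.Prime, Kfactor N p)
      Filter.atTop (nhds (K N)) := by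
  have hsum : Summable (fun p : Nat.Primes => ‖Kfactor N (p:ℕ) - 1‖) := by
    have h0 : Summable (fun n : ℕ => 4 * (1/(n:ℝ)^2)) :=
      (Real.summable_one_div_nat_pow.2 (by norm_num)).mul_left 4
    have h1 : Summable (fun p : Nat.Primes => 4 * (1/((p:ℕ):ℝ)^2)) :=
      h0.comp_injective (i := fun p : Nat.Primes => (p:ℕ)) Subtype.val_injective
    exact Summable.of_nonneg_of_le (fun _ => norm_nonneg _)
      (fun p => Kfactor_bound N p hN p.2) h1
  have hm := multipliable_one_add_of_summable hsum
  simp only [add_sub_cancel] at hm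
  have hp : HasProd (fun p : Nat.Primes => Kfactor N (p:ℕ)) (K N) := hm.hasProd
  have hp2 : HasProd (({p : ℕ | p.Prime} : Set ℕ).mulIndicator (Kfactor N)) (K N) :=
    hasProd_subtype_iff_mulIndicator.1 hp
  have := hp2.tendsto_prod_nat
  refine this.congr (fun n => ?_)
  rw [Finset.prod_filter]
  apply Finset.prod_congr rfl
  intro p _
  simp [Set.mulIndicator_apply]

lemma ratio_prod (N n : ℕ) (hN : 1 ≤ N) (hn : N < n) :
    (N:ℝ) / (Nat.totient N : ℝ) = ∏ p ∈ (Finset.range n).filter Nat.Prime,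
      (if p ∣ N then (p:ℝ)/((p:ℝ)-1) else 1) := by
  rw [← Finset.prod_filter]
  have hs : ((Finset.range n).filter Nat.Prime).filter (fun p => p ∣ N) = N.primeFactors := by
    ext p
    simp only [Finset.mem_filter, Finset.mem_range, Nat.mem_primeFactors]
    constructor
    · rintro ⟨⟨_, h⟩, h'⟩; exact ⟨h, h', by omega⟩
    · rintro ⟨h, h', _⟩; exact ⟨⟨lt_of_le_of_lt (Nat.le_of_dvd hN h') hn, h⟩, h'⟩
  rw [hs]
  have ht : (Nat.totient N : ℝ) = N * ∏ p ∈ N.primeFactors, (1 - (p:ℝ)⁻¹) := by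
    have := congrArg (Rat.cast : ℚ → ℝ) (Nat.totient_eq_mul_prod_factors N)
    push_cast at this
    exact this
  have hNR : (N:ℝ) ≠ 0 := by positivity
  rw [ht, div_mul_eq_div_div, div_self hNR, one_div, ← Finset.prod_inv_distrib]
  apply Finset.prod_congr rfl
  intro p hp
  have h2 : (2:ℝ) ≤ p := by exact_mod_cast (Nat.prime_of_mem_primeFactors hp).two_le
  have h3 : (p:ℝ) ≠ 0 := by linarith
  have h1 : (p:ℝ) - 1 ≠ 0 := by linarith
  have : 1 - (p:ℝ)⁻¹ = ((p:ℝ)-1)/p := by field_simp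
  rw [this, inv_div]

lemma fK_two (N : ℕ) (h : ¬ 2 ∣ N) : fK N 2 = 2/3 := by
  have : (2:ℤ) ∣ (N:ℤ) - 1 := by omega
  simp only [fK, Kfactor, h, if_false]
  norm_num [this]

lemma tail_sum (N z n : ℕ) (hN : 1 ≤ N) (hz : 2 ≤ z) :
    ∑ p ∈ (Finset.Ioo z n).filter Nat.Prime, ‖fK N p - 1‖
      ≤ ((N.primeFactors.card : ℝ) + 2) / z := by
  have hzR : (2:ℝ) ≤ z := by exact_mod_cast hz
  have h1 : ∀ p ∈ (Finset.Ioo z n).filter Nat.Prime, ‖fK N p - 1‖ ≤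
      1/((p:ℝ)-1)^2 + (if p ∣ N then 1/(z:ℝ) else 0) := by
    intro p hp
    simp only [Finset.mem_filter, Finset.mem_Ioo] at hp
    have hb := fK_bound N p hN hp.2 (by omega)
    have hpz : (z:ℝ) + 1 ≤ p := by exact_mod_cast hp.1.1
    refine le_trans hb ?_
    gcongr
    split_ifs
    · apply one_div_le_one_div_of_le <;> linarith
    · exact le_rfl
  refine le_trans (Finset.sum_le_sum h1) ?_
  rw [Finset.sum_add_distrib, add_div, add_comm]
  apply add_le_add
  · rw [← Finset.sum_filter, Finset.sum_const, nsmul_eq_mul, mul_one_div]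
    gcongr
    intro p hp
    simp only [Finset.mem_filter] at hp
    exact Nat.mem_primeFactors.2 ⟨hp.1.2, hp.2, by omega⟩
  · have h2 : ∑ p ∈ (Finset.Ioo z n).filter Nat.Prime, 1/((p:ℝ)-1)^2
        ≤ ∑ p ∈ Finset.Ioo z n, 1/((p:ℝ)-1)^2 :=
      Finset.sum_le_sum_of_subset_of_nonneg (Finset.filter_subset _ _) (fun _ _ _ => by positivity)
    refine le_trans h2 ?_
    have h3 : ∑ p ∈ Finset.Ioo z n, 1/((p:ℝ)-1)^2 = ∑ q ∈ Finset.Ioo (z-1) (n-1), ((q:ℝ)^2)⁻¹ := by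
      refine Finset.sum_nbij' (fun p => p - 1) (fun q => q + 1) ?_ ?_ ?_ ?_ ?_
      · intro p hp; simp only [Finset.mem_Ioo] at hp ⊢; omega
      · intro p hp; simp only [Finset.mem_Ioo] at hp ⊢; omega
      · intro p hp; simp only [Finset.mem_Ioo] at hp; omega
      · intro p hp; simp
      · intro p hp
        simp only [Finset.mem_Ioo] at hp
        rw [Nat.cast_sub (by omega)]; simp
    rw [h3]
    have := sum_Ioo_inv_sq_le (α := ℝ) (z-1) (n-1)
    rw [Nat.cast_sub (by omega)] at this
    simpa using this

lemma Kstar_approx (N z : ℕ) (hN : 1 ≤ N) (hodd : ¬ 2 ∣ N) (hz : 2 ≤ z) :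
    |Kstar N - 2/3 * ∏ p ∈ (Finset.Ioc 2 z).filter Nat.Prime, fK N p| ≤
      2/3 * (∏ p ∈ (Finset.Ioc 2 z).filter Nat.Prime, fK N p) *
        (Real.exp (((N.primeFactors.card : ℝ) + 2) / z) - 1) := by
  set P := ∏ p ∈ (Finset.Ioc 2 z).filter Nat.Prime, fK N p with hP
  have hP0 : 0 ≤ P := Finset.prod_nonneg (fun p hp => by
    simp only [Finset.mem_filter, Finset.mem_Ioc] at hp
    exact fK_nonneg N p hN hp.2 (by omega))
  have ht : Filter.Tendsto (fun n : ℕ =>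
      |(∏ p ∈ (Finset.range n).filter Nat.Prime, Kfactor N p) * ((N:ℝ) / (Nat.totient N : ℝ)) - 2/3 * P|)
      Filter.atTop (nhds |Kstar N - 2/3 * P|) := by
    have := (((K_tendsto N hN).mul_const ((N:ℝ) / (Nat.totient N : ℝ))).sub_const (2/3 * P)).abs
    unfold Kstar
    rw [mul_div_assoc]
    exact this
  refine le_of_tendsto ht ?_
  filter_upwards [Filter.eventually_gt_atTop (N + z)] with n hn
  rw [ratio_prod N n hN (by omega), ← Finset.prod_mul_distrib]
  change |∏ p ∈ (Finset.range n).filter Nat.Prime, fK N p - 2/3 * P| ≤ _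
  have hsplit : (Finset.range n).filter Nat.Prime =
      insert 2 ((Finset.Ioc 2 z).filter Nat.Prime ∪ (Finset.Ioo z n).filter Nat.Prime) := by
    ext p
    simp only [Finset.mem_filter, Finset.mem_range, Finset.mem_insert, Finset.mem_union,
      Finset.mem_Ioc, Finset.mem_Ioo]
    constructor
    · rintro ⟨h, hp⟩
      have := hp.two_le
      simp only [hp, and_true]
      omega
    · rintro (h | ⟨h, hp⟩ | ⟨h, hp⟩)
      · subst h; exact ⟨by omega, Nat.prime_two⟩
      · exact ⟨by omega, hp⟩
      · exact ⟨by omega, hp⟩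
  have hdis : Disjoint ((Finset.Ioc 2 z).filter Nat.Prime) ((Finset.Ioo z n).filter Nat.Prime) := by
    rw [Finset.disjoint_left]
    intro p hp hp'
    simp only [Finset.mem_filter, Finset.mem_Ioc, Finset.mem_Ioo] at hp hp'
    omega
  rw [hsplit, Finset.prod_insert (by simp; omega), Finset.prod_union hdis, fK_two N hodd, ← hP]
  set Q := ∏ p ∈ (Finset.Ioo z n).filter Nat.Prime, fK N p with hQ
  have hQb : |Q - 1| ≤ Real.exp (((N.primeFactors.card : ℝ) + 2) / z) - 1 := by
    have h1 := Finset.norm_prod_one_add_sub_one_le ((Finset.Ioo z n).filter Nat.Prime)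
      (fun p => fK N p - 1)
    simp only [add_sub_cancel] at h1
    rw [← hQ] at h1
    refine le_trans h1 ?_
    gcongr
    exact tail_sum N z n hN hz
  have : 2/3 * (P * Q) - 2/3 * P = 2/3 * P * (Q - 1) := by ring
  rw [this, abs_mul, abs_of_nonneg (by positivity)]
  exact mul_le_mul_of_nonneg_left hQb (by positivity)

lemma card_pf (N : ℕ) (hN : 1 ≤ N) : (N.primeFactors.card : ℝ) ≤ 2 * Real.log N := by
  have h1 : 2 ^ N.primeFactors.card ≤ N := by
    refine le_trans (Finset.pow_card_le_prod N.primeFactors (fun p => p) 2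
      (fun p hp => (Nat.prime_of_mem_primeFactors hp).two_le)) ?_
    exact Nat.le_of_dvd hN (Nat.prod_primeFactors_dvd N)
  have h2 : ((2:ℝ) ^ N.primeFactors.card) ≤ N := by exact_mod_cast h1
  have h3 := Real.log_le_log (by positivity) h2
  rw [Real.log_pow] at h3
  have := Real.log_two_gt_d9
  have h0 : (0:ℝ) ≤ N.primeFactors.card := by positivity
  nlinarith

theorem stmt_9 :
    ∃ C : ℝ, ∀ x : ℝ, 2 ≤ x →
      |(∑ N ∈ (Finset.Icc 1 ⌊x⌋₊).filter (fun N => ¬ 2 ∣ N), Kstar N) - x/3|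
        ≤ C * x / Real.log x := by
  refine ⟨160 * (4 * Real.exp 2) + 111, fun x hx => ?_⟩
  set L := Real.log x with hL
  have hx0 : 0 < x := by linarith
  have hL0 : (0.69:ℝ) < L := by
    have h1 := Real.log_two_gt_d9
    have h2 : Real.log 2 ≤ L := Real.log_le_log (by norm_num) hx
    linarith
  have hLp : 0 < L := by linarith
  have hexp : Real.exp L = x := Real.exp_log hx0
  have p1 : L ≤ x := by
    have := Real.pow_div_factorial_le_exp L hLp.le 1
    rw [hexp] at this; norm_num [Nat.factorial] at this; linarith
  have p3 : L^3 ≤ 6 * x := by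
    have := Real.pow_div_factorial_le_exp L hLp.le 3
    rw [hexp] at this; norm_num [Nat.factorial] at this; linarith
  have p5 : L^5 ≤ 120 * x := by
    have := Real.pow_div_factorial_le_exp L hLp.le 5
    rw [hexp] at this; norm_num [Nat.factorial] at this; linarith
  set X := ⌊x⌋₊ with hX
  have hXx : (X:ℝ) ≤ x := Nat.floor_le hx0.le
  have hxX : x < X + 1 := Nat.lt_floor_add_one x
  set z := ⌈L^2⌉₊ + 2 with hz
  have hz2 : 2 ≤ z := by omega
  have hzl : L^2 + 2 ≤ z := by
    have := Nat.le_ceil (L^2)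
    rw [hz]; push_cast; linarith
  have hzu : (z:ℝ) ≤ L^2 + 3 := by
    have := Nat.ceil_lt_add_one (sq_nonneg L)
    rw [hz]; push_cast; linarith
  have hz0 : (0:ℝ) < z := by positivity
  set S := (Finset.Ioc 2 z).filter Nat.Prime with hS
  have hSp : ∀ p ∈ S, p.Prime ∧ 3 ≤ p := by
    intro p hp
    simp only [hS, Finset.mem_filter, Finset.mem_Ioc] at hp
    exact ⟨hp.2, by omega⟩
  -- main term
  have hT : |TT S X 2 1 - (X:ℝ)/2| ≤ 165 * (x/L) := by
    have h1 := TT_bound X S hSp 2 1 (by norm_num) (fun p hp =>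
      (Nat.coprime_primes Nat.prime_two (hSp p hp).1).2 (by have := (hSp p hp).2; omega))
    have h2 := prod_B z hz2
    have h3 : (z:ℝ)^2 ≤ (L^2+3)^2 := by gcongr
    have h4 : (L^2+3)^2 ≤ 165 * (x/L) := by
      rw [← mul_div_assoc, le_div_iff₀ hLp]
      nlinarith
    push_cast at h1
    linarith
  have hTT : TT S X 2 1 = ∑ N ∈ (Finset.Icc 1 X).filter (fun N => ¬ 2 ∣ N), ∏ p ∈ S, fK N p := by
    unfold TT
    rw [Finset.sum_filter]
    apply Finset.sum_congr
    · ext N; simp only [Finset.mem_Ioc, Finset.mem_Icc]; omega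
    · intro N _
      have : N ≡ 1 [MOD 2] ↔ ¬ 2 ∣ N := by unfold Nat.ModEq; omega
      simp [this]
  -- tail
  have hδ : ∀ N ∈ (Finset.Icc 1 X).filter (fun N => ¬ 2 ∣ N),
      |Kstar N - 2/3 * ∏ p ∈ S, fK N p| ≤ 2/3 * (∏ p ∈ S, fK N p) * (4 * Real.exp 2 / L) := by
    intro N hN
    simp only [Finset.mem_filter, Finset.mem_Icc] at hN
    obtain ⟨⟨hN1, hNX⟩, hodd⟩ := hN
    refine le_trans (Kstar_approx N z hN1 hodd hz2) ?_
    have hP0 : 0 ≤ ∏ p ∈ S, fK N p :=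
      Finset.prod_nonneg (fun p hp => fK_nonneg N p hN1 (hSp p hp).1 (hSp p hp).2)
    refine mul_le_mul_of_nonneg_left ?_ (by positivity)
    have hc := card_pf N hN1
    have hNx : (N:ℝ) ≤ x := le_trans (by exact_mod_cast hNX) hXx
    have hlog : Real.log N ≤ L := Real.log_le_log (by exact_mod_cast hN1) hNx
    set τ := ((N.primeFactors.card : ℝ) + 2) / z with hτ
    have hτ0 : 0 ≤ τ := by positivity
    have hτ2 : τ ≤ 2 := by
      rw [hτ, div_le_iff₀ hz0]; nlinarith [sq_nonneg (L - 1)]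
    have hτL : τ ≤ 4 / L := by
      rw [hτ, div_le_div_iff₀ hz0 hLp]
      nlinarith [sq_nonneg (L - 1), mul_le_mul_of_nonneg_right hc hLp.le,
        mul_le_mul_of_nonneg_right hlog hLp.le]
    have e1 : Real.exp τ - 1 ≤ τ * Real.exp τ := by
      have h1 := Real.add_one_le_exp (-τ)
      have h2 : Real.exp (-τ) * Real.exp τ = 1 := by rw [← Real.exp_add]; simp
      have h3 := Real.exp_pos τ
      nlinarith
    calc Real.exp τ - 1 ≤ τ * Real.exp τ := e1
      _ ≤ (4 / L) * Real.exp 2 := by gcongr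
      _ = 4 * Real.exp 2 / L := by ring
  have hsum : |(∑ N ∈ (Finset.Icc 1 X).filter (fun N => ¬ 2 ∣ N), Kstar N) - 2/3 * TT S X 2 1|
      ≤ 2/3 * TT S X 2 1 * (4 * Real.exp 2 / L) := by
    rw [hTT, Finset.mul_sum, ← Finset.sum_sub_distrib, Finset.sum_mul]
    exact le_trans (Finset.abs_sum_le_sum_abs _ _) (Finset.sum_le_sum hδ)
  have hTu : TT S X 2 1 ≤ 240 * x := by
    have h1 := (abs_le.1 hT).2
    have h2 : x / L ≤ 1.45 * x := by
      rw [div_le_iff₀ hLp]; nlinarith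
    linarith
  have hD : 0 < 4 * Real.exp 2 / L := by positivity
  have h1 : 2/3 * TT S X 2 1 * (4 * Real.exp 2 / L) ≤ 2/3 * (240 * x) * (4 * Real.exp 2 / L) := by
    gcongr
  have hy : 1 ≤ x / L := by rw [le_div_iff₀ hLp]; linarith
  have hfin : (160 * (4 * Real.exp 2) + 111) * x / L
      = 2/3 * (240 * x) * (4 * Real.exp 2 / L) + 111 * (x/L) := by ring
  rw [hfin]
  have a1 := abs_le.1 hsum
  have a2 := abs_le.1 hT
  rw [abs_le]
  constructor <;> linarith [a1.1, a1.2, a2.1, a2.2]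
end
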